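/- arXiv:1003.2114 — 6 statements merged into one kernel-verified Lean document; each statement's English description precedes it below -/
import Mathlib

section
/- Let (M, d) be a metric space with d(x, y) ≤ π for all x, y ∈ M. Let φ₀, φ₁, ψ₀, ψ₁ ∈ M and r, s > 0 satisfy d(φ₀, φ₁) = π, d(ψ₀, ψ₁) = π, d(φ₀, ψ₁) < π and d(ψ₀, φ₁) < π. Then d_Con((φ₀, r), (ψ₁, s))² + d_Con((ψ₀, s), (φ₁, r))² < d_Con((φ₀, r), (φ₁, r))² + d_Con((ψ₀, s), (ψ₁, s))², where d_Con((x, s), (y, t)) = √(s² + t² − 2·s·t·cos(d(x, y))). (This is the key inequality in the proof of Lemma 2.6: two distinct antipodal pairs would violate d²-cyclical monotonicity of an optimal coupling on the Euclidean cone.) -/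
open Real

/-- The Euclidean cone distance on `M × [0,∞)`. -/
noncomputable def dCon {M : Type*} [MetricSpace M] (p q : M × ℝ) : ℝ :=
  Real.sqrt (p.2 ^ 2 + q.2 ^ 2 - 2 * p.2 * q.2 * Real.cos (dist p.1 q.1))

/-- Key inequality in the proof of Lemma 2.6: two distinct antipodal pairs would violate
`d_Con²`-cyclical monotonicity of an optimal coupling on the Euclidean cone. -/
theorem euclidean_cone_two_antipodal_pairs_inequality
    {M : Type*} [MetricSpace M] (hdiam : ∀ x y : M, dist x y ≤ π)
    (φ₀ φ₁ ψ₀ ψ₁ : M) (r s : ℝ) (hr : 0 < r) (hs : 0 < s)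
    (hφ : dist φ₀ φ₁ = π) (hψ : dist ψ₀ ψ₁ = π)
    (hφψ : dist φ₀ ψ₁ < π) (hψφ : dist ψ₀ φ₁ < π) :
    dCon (φ₀, r) (ψ₁, s) ^ 2 + dCon (ψ₀, s) (φ₁, r) ^ 2 <
      dCon (φ₀, r) (φ₁, r) ^ 2 + dCon (ψ₀, s) (ψ₁, s) ^ 2 := by
  have key : ∀ (x y : M) (a b : ℝ), 0 < a → 0 < b →
      dCon (x, a) (y, b) ^ 2 = a ^ 2 + b ^ 2 - 2 * a * b * Real.cos (dist x y) := by
    intro x y a b ha hb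
    unfold dCon
    apply Real.sq_sqrt
    have h1 := Real.cos_le_one (dist x y)
    have h2 := mul_pos ha hb
    show 0 ≤ a ^ 2 + b ^ 2 - 2 * a * b * Real.cos (dist x y)
    nlinarith [sq_nonneg (a - b), mul_nonneg h2.le (sub_nonneg.2 h1)]
  have hc : ∀ x y : M, dist x y < π → -1 < Real.cos (dist x y) := by
    intro x y h
    rw [← Real.cos_pi]
    exact Real.cos_lt_cos_of_nonneg_of_le_pi dist_nonneg le_rfl h
  rw [key _ _ _ _ hr hs, key _ _ _ _ hs hr, key _ _ _ _ hr hr, key _ _ _ _ hs hs, hφ, hψ,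
    Real.cos_pi]
  have h1 := hc _ _ hφψ
  have h2 := hc _ _ hψφ
  have h3 := mul_pos hr hs
  nlinarith [sq_nonneg (r - s), mul_pos h3 (sub_pos.2 h1), mul_pos h3 (sub_pos.2 h2)]
end

section
/- Let (M, d) be a metric space with d(x, y) ≤ π for all x, y ∈ M, and assume that every point of M has at most one antipode (i.e. for each φ ∈ M there is at most one φ' ∈ M with d(φ, φ') = π). Let Ξ ⊆ (M × (0, ∞)) × (M × (0, ∞)) be 2-cyclically monotone for the squared Euclidean cone distance, meaning that for all ((a₀, a₁), (b₀, b₁)) ∈ Ξ × Ξ one has d_Con(a₀, a₁)² + d_Con(b₀, b₁)² ≤ d_Con(a₀, b₁)² + d_Con(b₀, a₁)². If ((φ₀, r), (φ₁, r)) ∈ Ξ and ((ψ₀, s), (ψ₁, s)) ∈ Ξ with r, s > 0, d(φ₀, φ₁) = π and d(ψ₀, ψ₁) = π, then φ₀ = ψ₀ and φ₁ = ψ₁. (Lemma 2.6 of the paper: there is at most one pair of antipodes through which a cyclically monotone transport on the Euclidean cone can pass the apex.) -/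
open Real

/-- Lemma 2.6: there is at most one pair of antipodes through which a cyclically monotone
transport on the Euclidean cone can pass the apex. -/
theorem euclidean_cone_unique_antipodal_pair
    {M : Type*} [MetricSpace M] (hdiam : ∀ x y : M, dist x y ≤ π)
    (hantip : ∀ φ φ' φ'' : M, dist φ φ' = π → dist φ φ'' = π → φ' = φ'')
    (Ξ : Set ((M × ℝ) × (M × ℝ)))
    (hsub : ∀ p ∈ Ξ, 0 < p.1.2 ∧ 0 < p.2.2)
    (hmono : ∀ a ∈ Ξ, ∀ b ∈ Ξ,
      dCon a.1 a.2 ^ 2 + dCon b.1 b.2 ^ 2 ≤ dCon a.1 b.2 ^ 2 + dCon b.1 a.2 ^ 2)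
    (φ₀ φ₁ ψ₀ ψ₁ : M) (r s : ℝ) (hr : 0 < r) (hs : 0 < s)
    (hφΞ : ((φ₀, r), (φ₁, r)) ∈ Ξ) (hψΞ : ((ψ₀, s), (ψ₁, s)) ∈ Ξ)
    (hφ : dist φ₀ φ₁ = π) (hψ : dist ψ₀ ψ₁ = π) :
    φ₀ = ψ₀ ∧ φ₁ = ψ₁ := by
  have key : ∀ (x y : M) (a b : ℝ), dCon (x, a) (y, b) ^ 2
      = a ^ 2 + b ^ 2 - 2 * a * b * Real.cos (dist x y) := by
    intro x y a b
    unfold dCon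
    apply Real.sq_sqrt
    simp only
    nlinarith [sq_nonneg (a - b * Real.cos (dist x y)),
      mul_nonneg (sq_nonneg b) (sub_nonneg.2 (Real.cos_sq_le_one (dist x y)))]
  have hpi : ∀ x y : M, Real.cos (dist x y) ≤ -1 → dist x y = π := by
    intro x y h
    have h1 : Real.cos (dist x y) = Real.cos π := by
      rw [Real.cos_pi]
      exact le_antisymm h (Real.neg_one_le_cos _)
    exact Real.injOn_cos ⟨dist_nonneg, hdiam x y⟩ ⟨Real.pi_pos.le, le_rfl⟩ h1
  have h := hmono _ hφΞ _ hψΞ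
  simp only [key, hφ, hψ, Real.cos_pi] at h
  have h1 := Real.neg_one_le_cos (dist φ₀ ψ₁)
  have h2 := Real.neg_one_le_cos (dist ψ₀ φ₁)
  have hrs := mul_pos hr hs
  have hsum : Real.cos (dist φ₀ ψ₁) + Real.cos (dist ψ₀ φ₁) ≤ -2 := by
    by_contra hc
    push Not at hc
    nlinarith [sq_nonneg (r - s), mul_pos hrs (sub_pos.2 hc)]
  have e1 := hpi φ₀ ψ₁ (by linarith)
  have e2 := hpi ψ₀ φ₁ (by linarith)
  refine ⟨hantip φ₁ _ _ ?_ ?_, hantip φ₀ _ _ hφ e1⟩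
  · rw [dist_comm]; exact hφ
  · rw [dist_comm]; exact e2
end

section
/- Let s ∈ (0, 1), let r be a real number with 0 < r ≤ s·π, and let θ ∈ [0, π]. If cos(r/s) = cos(r)·cos(((1−s)/s)·r) + sin(r)·sin(((1−s)/s)·r)·cos(θ), then θ = π. (This is Lemma 3.3 of the paper: if a geodesic in the spherical cone from (φ₀, r) to (φ₁, (1−s)r/s) passes through the south pole at parameter s, where θ = d(φ₀, φ₁), then φ₀ and φ₁ are antipodes.) -/
open Real

/-- Lemma 3.3: if a geodesic in the spherical cone from `(φ₀, r)` to `(φ₁, (1−s)r/s)`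
passes through the south pole at parameter `s`, where `θ = d(φ₀, φ₁)`, then `θ = π`. -/
theorem spherical_cone_pole_antipodes
    (s r θ : ℝ) (hs₀ : 0 < s) (hs₁ : s < 1) (hr₀ : 0 < r) (hr : r ≤ s * π)
    (hθ₀ : 0 ≤ θ) (hθπ : θ ≤ π)
    (h : Real.cos (r / s) =
      Real.cos r * Real.cos (((1 - s) / s) * r) +
        Real.sin r * Real.sin (((1 - s) / s) * r) * Real.cos θ) :
    θ = π := by
  have hb : r / s = r + ((1 - s) / s) * r := by field_simp; ring
  have hle : r / s ≤ π := by rw [div_le_iff₀ hs₀]; linarith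
  have hb0 : 0 < ((1 - s) / s) * r := mul_pos (div_pos (by linarith) hs₀) hr₀
  rw [hb] at h hle
  have h1 : 0 < Real.sin r := Real.sin_pos_of_pos_of_lt_pi hr₀ (by linarith)
  have h2 : 0 < Real.sin (((1 - s) / s) * r) :=
    Real.sin_pos_of_pos_of_lt_pi hb0 (by linarith)
  rw [Real.cos_add] at h
  have h3 : Real.cos θ = Real.cos π := by
    rw [Real.cos_pi]
    apply mul_left_cancel₀ (mul_pos h1 h2).ne'
    linarith
  exact Real.injOn_cos ⟨hθ₀, hθπ⟩ ⟨Real.pi_pos.le, le_rfl⟩ h3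
end

section
/- Let (M, d) be a metric space with d(x, y) ≤ π for all x, y ∈ M. Let s ∈ (0, 1), let r, t be real numbers with 0 < r ≤ s·π and 0 < t ≤ s·π, and let φ₀, φ₁, ψ₀, ψ₁ ∈ M satisfy d(φ₀, φ₁) = π, d(ψ₀, ψ₁) = π, d(φ₀, ψ₁) < π and d(ψ₀, φ₁) < π. Then arccos(cos(r)·cos(((1−s)/s)·t) + sin(r)·sin(((1−s)/s)·t)·cos(d(φ₀, ψ₁)))² + arccos(cos(((1−s)/s)·r)·cos(t) + sin(((1−s)/s)·r)·sin(t)·cos(d(ψ₀, φ₁)))² < (r/s)² + (t/s)². In other words, d_Σ((φ₀, r), (ψ₁, (1−s)t/s))² + d_Σ((ψ₀, t), (φ₁, (1−s)r/s))² < d_Σ((φ₀, r), (φ₁, (1−s)r/s))² + d_Σ((ψ₀, t), (ψ₁, (1−s)t/s))². (This is the key inequality in the proof of Lemma 3.5: two distinct antipodal pairs would violate d_Σ²-cyclical monotonicity of an optimal coupling on the spherical cone.) -/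
open Real

/-- The spherical cone distance on `M × [0,π]`. -/
noncomputable def dSigma {M : Type*} [MetricSpace M] (p q : M × ℝ) : ℝ :=
  Real.arccos (Real.cos p.2 * Real.cos q.2 +
    Real.sin p.2 * Real.sin q.2 * Real.cos (dist p.1 q.1))

theorem dSigma_lt_aux {M : Type*} [MetricSpace M] (x y : M) (u v : ℝ) (hu : 0 < u) (hu' : u < π)
    (hv : 0 < v) (hv' : v < π) (huv : u + v ≤ π) (hd : dist x y < π) :
    dSigma (x, u) (y, v) < u + v := by
  have h1 := Real.sin_pos_of_pos_of_lt_pi hu hu'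
  have h2 := Real.sin_pos_of_pos_of_lt_pi hv hv'
  have h3 : -1 < Real.cos (dist x y) := by
    rw [← Real.cos_pi]
    exact Real.cos_lt_cos_of_nonneg_of_le_pi dist_nonneg le_rfl hd
  have h4 : Real.cos (u + v) < Real.cos u * Real.cos v +
      Real.sin u * Real.sin v * Real.cos (dist x y) := by
    rw [Real.cos_add]
    nlinarith [mul_pos h1 h2]
  unfold dSigma
  dsimp only
  by_contra hc
  rw [not_lt] at hc
  have h5 := Real.cos_le_cos_of_nonneg_of_le_pi (by linarith) (Real.arccos_le_pi _) hc
  rw [Real.cos_arccos] at h5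
  · linarith
  · linarith [Real.neg_one_le_cos (u + v)]
  · have h6 := Real.cos_le_one (u - v)
    rw [Real.cos_sub] at h6
    nlinarith [mul_pos h1 h2, Real.cos_le_one (dist x y)]

/-- Key inequality in the proof of Lemma 3.5: two distinct antipodal pairs would violate
`d_Σ²`-cyclical monotonicity of an optimal coupling on the spherical cone. -/
theorem spherical_cone_two_antipodal_pairs_inequality
    {M : Type*} [MetricSpace M] (hdiam : ∀ x y : M, dist x y ≤ π)
    (s r t : ℝ) (hs₀ : 0 < s) (hs₁ : s < 1)
    (hr₀ : 0 < r) (hr : r ≤ s * π) (ht₀ : 0 < t) (ht : t ≤ s * π)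
    (φ₀ φ₁ ψ₀ ψ₁ : M)
    (hφ : dist φ₀ φ₁ = π) (hψ : dist ψ₀ ψ₁ = π)
    (hφψ : dist φ₀ ψ₁ < π) (hψφ : dist ψ₀ φ₁ < π) :
    dSigma (φ₀, r) (ψ₁, ((1 - s) / s) * t) ^ 2 +
        dSigma (ψ₀, t) (φ₁, ((1 - s) / s) * r) ^ 2 <
      (r / s) ^ 2 + (t / s) ^ 2 := by
  obtain ⟨a, rfl⟩ : ∃ a, r = s * a := ⟨r / s, by field_simp⟩
  obtain ⟨b, rfl⟩ : ∃ b, t = s * b := ⟨t / s, by field_simp⟩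
  have ha : 0 < a := pos_of_mul_pos_right hr₀ hs₀.le
  have hb : 0 < b := pos_of_mul_pos_right ht₀ hs₀.le
  have ha' : a ≤ π := le_of_mul_le_mul_left hr hs₀
  have hb' : b ≤ π := le_of_mul_le_mul_left ht hs₀
  have e1 : (1 - s) / s * (s * b) = (1 - s) * b := by field_simp
  have e2 : (1 - s) / s * (s * a) = (1 - s) * a := by field_simp
  have e3 : s * a / s = a := by field_simp
  have e4 : s * b / s = b := by field_simp
  rw [e1, e2, e3, e4]
  have hs' : 0 < 1 - s := by linarith
  have hpi := Real.pi_pos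
  have k1 : (1 - s) * a ≤ (1 - s) * π := mul_le_mul_of_nonneg_left ha' hs'.le
  have k2 : (1 - s) * b ≤ (1 - s) * π := mul_le_mul_of_nonneg_left hb' hs'.le
  have k3 : s * π < π := by nlinarith
  have k4 : (1 - s) * π < π := by nlinarith
  have D1 := dSigma_lt_aux φ₀ ψ₁ (s * a) ((1 - s) * b) hr₀ (by linarith) (mul_pos hs' hb)
    (by linarith) (by linarith) hφψ
  have D2 := dSigma_lt_aux ψ₀ φ₁ (s * b) ((1 - s) * a) ht₀ (by linarith) (mul_pos hs' ha)
    (by linarith) (by linarith) hψφ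
  have E1 := pow_lt_pow_left₀ D1 (Real.arccos_nonneg _) two_ne_zero
  have E2 := pow_lt_pow_left₀ D2 (Real.arccos_nonneg _) two_ne_zero
  have E3 : 0 ≤ (s * (1 - s)) * (a - b) ^ 2 := by positivity
  nlinarith
end

section
/- Let (M, d) be a metric space with d(x, y) ≤ π for all x, y ∈ M, and assume that every point of M has at most one antipode (i.e. for each φ ∈ M there is at most one φ' ∈ M with d(φ, φ') = π). Fix s ∈ (0, 1) and let Ξ ⊆ (M × (0, π)) × (M × (0, π)) be 2-cyclically monotone for the squared spherical cone distance, meaning that for all ((a₀, a₁), (b₀, b₁)) ∈ Ξ × Ξ one has d_Σ(a₀, a₁)² + d_Σ(b₀, b₁)² ≤ d_Σ(a₀, b₁)² + d_Σ(b₀, a₁)². If ((φ₀, r), (φ₁, (1−s)r/s)) ∈ Ξ and ((ψ₀, t), (ψ₁, (1−s)t/s)) ∈ Ξ with 0 < r ≤ s·π, 0 < t ≤ s·π, d(φ₀, φ₁) = π and d(ψ₀, ψ₁) = π, then φ₀ = ψ₀ and φ₁ = ψ₁. (Lemma 3.5 of the paper: there is at most one pair of antipodes through which a cyclically monotone transport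 on the spherical cone can pass the south pole.) -/
open Real

theorem aux_le {M : Type*} [MetricSpace M] (x y : M) (a b : ℝ)
    (ha : 0 < a) (hb : 0 < b) (ha' : a < π) (hb' : b < π) (hab : a + b ≤ π) :
    dSigma (x, a) (y, b) ≤ a + b := by
  have h1 := Real.sin_pos_of_pos_of_lt_pi ha ha'
  have h2 := Real.sin_pos_of_pos_of_lt_pi hb hb'
  have h3 := mul_pos h1 h2
  have h := Real.arccos_cos (by linarith : 0 ≤ a + b) hab
  unfold dSigma
  refine le_of_le_of_eq (Real.arccos_le_arccos ?_) h
  rw [Real.cos_add]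
  have := Real.neg_one_le_cos (dist x y)
  simp only
  nlinarith

theorem aux_lt {M : Type*} [MetricSpace M] (x y : M) (a b : ℝ)
    (ha : 0 < a) (hb : 0 < b) (ha' : a < π) (hb' : b < π) (hab : a + b ≤ π)
    (hd : dist x y < π) :
    dSigma (x, a) (y, b) < a + b := by
  have h1 := Real.sin_pos_of_pos_of_lt_pi ha ha'
  have h2 := Real.sin_pos_of_pos_of_lt_pi hb hb'
  have h3 := mul_pos h1 h2
  have h := Real.arccos_cos (by linarith : 0 ≤ a + b) hab
  have hc := Real.cos_lt_cos_of_nonneg_of_le_pi dist_nonneg le_rfl hd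
  rw [Real.cos_pi] at hc
  have hc1 := Real.cos_le_one (dist x y)
  have h4 := Real.cos_le_one (a - b)
  rw [Real.cos_sub] at h4
  unfold dSigma
  refine lt_of_lt_of_eq (Real.arccos_lt_arccos (Real.neg_one_le_cos _) ?_ ?_) h
  · rw [Real.cos_add]
    simp only
    nlinarith
  · simp only
    nlinarith

theorem aux_eq {M : Type*} [MetricSpace M] (x y : M) (a b : ℝ)
    (ha : 0 < a) (hb : 0 < b) (hab : a + b ≤ π)
    (hd : dist x y = π) :
    dSigma (x, a) (y, b) = a + b := by
  have h := Real.arccos_cos (by linarith : 0 ≤ a + b) hab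
  unfold dSigma
  rw [← h, Real.cos_add]
  simp only [hd, Real.cos_pi]
  congr 1
  ring

theorem aux_nonneg {M : Type*} [MetricSpace M] (p q : M × ℝ) : 0 ≤ dSigma p q :=
  Real.arccos_nonneg _

/-- Lemma 3.5: there is at most one pair of antipodes through which a cyclically monotone
transport on the spherical cone can pass the south pole. -/
theorem spherical_cone_unique_antipodal_pair
    {M : Type*} [MetricSpace M] (hdiam : ∀ x y : M, dist x y ≤ π)
    (hantip : ∀ φ φ' φ'' : M, dist φ φ' = π → dist φ φ'' = π → φ' = φ'')
    (s : ℝ) (hs₀ : 0 < s) (hs₁ : s < 1)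
    (Ξ : Set ((M × ℝ) × (M × ℝ)))
    (hsub : ∀ p ∈ Ξ, (0 < p.1.2 ∧ p.1.2 < π) ∧ (0 < p.2.2 ∧ p.2.2 < π))
    (hmono : ∀ a ∈ Ξ, ∀ b ∈ Ξ,
      dSigma a.1 a.2 ^ 2 + dSigma b.1 b.2 ^ 2 ≤
        dSigma a.1 b.2 ^ 2 + dSigma b.1 a.2 ^ 2)
    (φ₀ φ₁ ψ₀ ψ₁ : M) (r t : ℝ)
    (hr₀ : 0 < r) (hr : r ≤ s * π) (ht₀ : 0 < t) (ht : t ≤ s * π)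
    (hφΞ : ((φ₀, r), (φ₁, ((1 - s) / s) * r)) ∈ Ξ)
    (hψΞ : ((ψ₀, t), (ψ₁, ((1 - s) / s) * t)) ∈ Ξ)
    (hφ : dist φ₀ φ₁ = π) (hψ : dist ψ₀ ψ₁ = π) :
    φ₀ = ψ₀ ∧ φ₁ = ψ₁ := by
  obtain ⟨⟨-, hr1⟩, hr2, hr3⟩ := hsub _ hφΞ
  obtain ⟨⟨-, ht1⟩, ht2, ht3⟩ := hsub _ hψΞ
  have hm := hmono _ hφΞ _ hψΞ
  simp only at hr1 hr2 hr3 ht1 ht2 ht3 hm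
  have hk : 0 < (1 - s) / s := div_pos (by linarith) hs₀
  have hks : (1 - s) / s * (s * π) = (1 - s) * π := by field_simp
  have hr' := mul_le_mul_of_nonneg_left hr hk.le
  have ht' := mul_le_mul_of_nonneg_left ht hk.le
  rw [hks] at hr' ht'
  have hquad : 0 ≤ (1 - s) / s * (r - t) ^ 2 := by positivity
  generalize (1 - s) / s = k at *
  rw [aux_eq φ₀ φ₁ r (k * r) hr₀ hr2 (by linarith) hφ,
    aux_eq ψ₀ ψ₁ t (k * t) ht₀ ht2 (by linarith) hψ] at hm
  have l1 := pow_le_pow_left₀ (aux_nonneg _ _)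
    (aux_le φ₀ ψ₁ r (k * t) hr₀ ht2 hr1 ht3 (by linarith)) 2
  have key : dist φ₀ ψ₁ = π := by
    by_contra hne
    have l3 := pow_lt_pow_left₀
      (aux_lt φ₀ ψ₁ r (k * t) hr₀ ht2 hr1 ht3 (by linarith)
        (lt_of_le_of_ne (hdiam _ _) hne)) (aux_nonneg _ _) two_ne_zero
    have l2 := pow_le_pow_left₀ (aux_nonneg _ _)
      (aux_le ψ₀ φ₁ t (k * r) ht₀ hr2 ht1 hr3 (by linarith)) 2
    nlinarith
  have e : φ₁ = ψ₁ := hantip _ _ _ hφ key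
  refine ⟨hantip ψ₁ _ _ (by rw [dist_comm]; exact key) (by rw [dist_comm]; exact hψ), e⟩
end

section
/- Let (M, d) be a metric space with d(x, y) ≤ π for all x, y ∈ M. Define D on (M × [0, π]) × (M × [0, π]) by D((x, s), (y, t)) = arccos(cos s · cos t + sin s · sin t · cos(d(x, y))). Then D satisfies the triangle inequality: for all p, q, z ∈ M × [0, π], D(p, z) ≤ D(p, q) + D(q, z). (This is the triangle inequality for the spherical cone metric d_Σ on Σ(M), which the paper uses throughout.) -/
open Real

lemma cone_vec_angle (s a t b : ℝ) :
    InnerProductGeometry.angle (!₂[sin s * cos a, sin s * sin a, cos s] : EuclideanSpace ℝ (Fin 3))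
      !₂[sin t * cos b, sin t * sin b, cos t]
      = arccos (cos s * cos t + sin s * sin t * cos (a - b)) := by
  have hn : ∀ s a : ℝ,
      ‖(!₂[sin s * cos a, sin s * sin a, cos s] : EuclideanSpace ℝ (Fin 3))‖ = 1 := by
    intro s a
    rw [EuclideanSpace.norm_eq, Real.sqrt_eq_one]
    simp [Fin.sum_univ_three]
    linear_combination sin s ^ 2 * sin_sq_add_cos_sq a + sin_sq_add_cos_sq s
  unfold InnerProductGeometry.angle
  rw [hn, hn]
  congr 1
  simp [PiLp.inner_apply, Fin.sum_univ_three, cos_sub]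
  ring

lemma cone_model (s t u a b : ℝ) :
    arccos (cos s * cos u + sin s * sin u * cos (a + b)) ≤
      arccos (cos s * cos t + sin s * sin t * cos a) +
      arccos (cos t * cos u + sin t * sin u * cos b) := by
  have h := InnerProductGeometry.angle_le_angle_add_angle
    (!₂[sin s * cos a, sin s * sin a, cos s] : EuclideanSpace ℝ (Fin 3))
    !₂[sin t * cos 0, sin t * sin 0, cos t]
    !₂[sin u * cos (-b), sin u * sin (-b), cos u]
  rw [cone_vec_angle, cone_vec_angle, cone_vec_angle] at h
  simpa using h

lemma cone_mono {s t a b : ℝ} (hs : s ∈ Set.Icc 0 π) (ht : t ∈ Set.Icc 0 π)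
    (ha : 0 ≤ a) (hab : a ≤ b) (hb : b ≤ π) :
    arccos (cos s * cos t + sin s * sin t * cos a) ≤
      arccos (cos s * cos t + sin s * sin t * cos b) := by
  apply Real.arccos_le_arccos
  have h1 := mul_nonneg (sin_nonneg_of_mem_Icc hs) (sin_nonneg_of_mem_Icc ht)
  have h2 := cos_le_cos_of_nonneg_of_le_pi ha hb hab
  have := mul_le_mul_of_nonneg_left h2 h1
  linarith

/-- Triangle inequality for the spherical cone metric `d_Σ`. -/
theorem spherical_cone_triangle_inequality
    {M : Type*} [MetricSpace M] (hdiam : ∀ x y : M, dist x y ≤ π)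
    (p q z : M × ℝ)
    (hp : p.2 ∈ Set.Icc 0 π) (hq : q.2 ∈ Set.Icc 0 π) (hz : z.2 ∈ Set.Icc 0 π) :
    dSigma p z ≤ dSigma p q + dSigma q z := by
  unfold dSigma
  have hpq := hdiam p.1 q.1
  have hb : 0 ≤ min (dist q.1 z.1) (π - dist p.1 q.1) :=
    le_min dist_nonneg (by linarith)
  have hc : dist p.1 z.1 ≤ dist p.1 q.1 + min (dist q.1 z.1) (π - dist p.1 q.1) := by
    rcases min_choice (dist q.1 z.1) (π - dist p.1 q.1) with h | h <;> rw [h]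
    · exact dist_triangle _ _ _
    · linarith [hdiam p.1 z.1]
  have hpi : dist p.1 q.1 + min (dist q.1 z.1) (π - dist p.1 q.1) ≤ π := by
    linarith [min_le_right (dist q.1 z.1) (π - dist p.1 q.1)]
  have h1 := cone_mono hp hz dist_nonneg hc hpi
  have h2 := cone_mono hq hz hb (min_le_left _ _) (hdiam q.1 z.1)
  have h3 := cone_model p.2 q.2 z.2 (dist p.1 q.1) (min (dist q.1 z.1) (π - dist p.1 q.1))
  linarith
end
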